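/- Let φ be analytic in the open upper half-plane ℂ₊ with positive real part (a Carathéodory function). Then there exist A ∈ ℝ, B ≥ 0, and a positive Borel measure μ on ℝ with ∫ dμ(t)/(t²+1) < ∞ such that φ(z) = iA − iBz − i ∫_ℝ (1/(t−z) − t/(t²+1)) dμ(t) for all z ∈ ℂ₊. -/

import Mathlib

open MeasureTheory Complex

open Metric Set Filter Topology
open scoped Real ComplexConjugate

/-- **Schwarz integral formula** on the unit disk: a holomorphic function is recovered from its
real part on the unit circle and the imaginary part of its value at the centre. -/
theorem DiffContOnCl.circleAverage_herglotzRieszKernel_mul_re {f : ℂ → ℂ} {w : ℂ}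
    (hf : DiffContOnCl ℂ f (ball 0 1)) (hw : w ∈ ball (0 : ℂ) 1) :
    Real.circleAverage (fun ζ ↦ herglotzRieszKernel 0 w ζ * ((f ζ).re : ℂ)) 0 1
      = f w - I * (f 0).im := by
  have hw1 : ‖w‖ < 1 := by simpa using hw
  have hden : ∀ ζ ∈ closedBall (0 : ℂ) 1, 1 - conj w * ζ ≠ 0 := by
    intro ζ hζ h0
    have h1 : ‖conj w * ζ‖ = 1 := by rw [← sub_eq_zero.1 h0]; simp
    rw [norm_mul, RCLike.norm_conj] at h1
    have : ‖ζ‖ ≤ 1 := by simpa using hζ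
    nlinarith [norm_nonneg w, norm_nonneg ζ]
  have hfs : ContinuousOn f (sphere 0 1) :=
    hf.2.mono (sphere_subset_closedBall.trans_eq (closure_ball 0 one_ne_zero).symm)
  have hne : ∀ ζ ∈ sphere (0 : ℂ) 1, ζ - w ≠ 0 := by
    intro ζ hζ h0
    rw [sub_eq_zero.1 h0] at hζ
    simp at hζ; linarith
  have hden' : ∀ ζ ∈ sphere (0 : ℂ) 1, 1 - conj w * ζ ≠ 0 :=
    fun ζ hζ ↦ hden ζ (sphere_subset_closedBall hζ)
  have cauchy : Real.circleAverage (fun ζ ↦ (ζ / (ζ - w)) * f ζ) 0 1 = f w := by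
    have := DiffContOnCl.circleAverage_smul_div (f := f) (c := 0) (R := 1) (w := w)
      (by simpa using hf) (by simpa using hw)
    simpa using this
  have mean : Real.circleAverage f 0 1 = f 0 :=
    DiffContOnCl.circleAverage (by simpa using hf)
  have dual : Real.circleAverage (fun ζ ↦ ((1 + conj w * ζ) / (1 - conj w * ζ)) * f ζ) 0 1
      = f 0 := by
    have hd : DiffContOnCl ℂ (fun ζ ↦ (1 + conj w * ζ) / (1 - conj w * ζ)) (ball 0 1) := by
      apply DifferentiableOn.diffContOnCl
      rw [closure_ball 0 one_ne_zero]
      fun_prop (disch := exact hden)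
    have := DiffContOnCl.circleAverage (c := 0) (R := 1) (f := fun ζ ↦
      ((1 + conj w * ζ) / (1 - conj w * ζ)) * f ζ) (by simpa using hd.smul hf)
    simpa using this
  have hconj : Real.circleAverage
      (fun ζ ↦ conj (((1 + conj w * ζ) / (1 - conj w * ζ)) * f ζ)) 0 1 = conj (f 0) := by
    rw [← dual]
    refine Complex.conjCLE.toContinuousLinearMap.circleAverage_comp_comm ?_
    apply ContinuousOn.circleIntegrable zero_le_one
    fun_prop (disch := exact hden')
  have key : EqOn (fun ζ ↦ herglotzRieszKernel 0 w ζ * ((f ζ).re : ℂ))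
      ((fun ζ ↦ (ζ / (ζ - w)) * f ζ) + ((-(1 / 2 : ℂ)) • f +
        (1 / 2 : ℂ) • fun ζ ↦ conj (((1 + conj w * ζ) / (1 - conj w * ζ)) * f ζ)))
      (sphere 0 |1|) := by
    intro ζ hζ
    rw [abs_one] at hζ
    have h1 := hne ζ hζ
    have hz : ζ ≠ 0 := by rintro rfl; simp at hζ
    have hcz : conj ζ = ζ⁻¹ := by
      rw [Complex.inv_def, Complex.normSq_eq_norm_sq]
      simp [show ‖ζ‖ = 1 by simpa using hζ]
    have hre : ((f ζ).re : ℂ) = (f ζ + conj (f ζ)) / 2 := by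
      rw [Complex.add_conj]; simp
    have h3 : (1 + w * ζ⁻¹) / (1 - w * ζ⁻¹) = (ζ + w) / (ζ - w) := by
      rw [show 1 + w * ζ⁻¹ = (ζ + w) * ζ⁻¹ by field_simp,
        show 1 - w * ζ⁻¹ = (ζ - w) * ζ⁻¹ by field_simp, mul_div_mul_right _ _ (inv_ne_zero hz)]
    simp only [herglotzRieszKernel_def, Pi.add_apply, Pi.smul_apply, smul_eq_mul, map_mul, map_div₀,
      map_add, map_sub, map_one, Complex.conj_conj, hcz, hre, h3, sub_zero]
    field_simp
    ring
  rw [Real.circleAverage_congr_sphere key, Real.circleAverage_add, Real.circleAverage_add,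
    Real.circleAverage_smul, Real.circleAverage_smul, cauchy, mean, hconj]
  · apply Complex.ext
    · simp
    · simp
      ring
  all_goals
    apply ContinuousOn.circleIntegrable zero_le_one
    try simp only [Pi.add_def, Pi.smul_def]
    fun_prop (disch := assumption)

/-- A nonnegative continuous density on the unit circle defines a finite measure that integrates
like a weighted circle average. -/
theorem exists_finiteMeasure_integral_eq_circleAverage {u : ℂ → ℝ}
    (hu : ContinuousOn u (sphere 0 1)) (hu0 : ∀ ζ ∈ sphere (0 : ℂ) 1, 0 ≤ u ζ) :
    ∃ ν : FiniteMeasure (sphere (0 : ℂ) 1), ∀ g : ℂ → ℂ, ContinuousOn g (sphere 0 1) →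
      ∫ ζ, g ζ ∂(ν : Measure (sphere (0 : ℂ) 1))
        = Real.circleAverage (fun ζ ↦ g ζ * (u ζ : ℂ)) 0 1 := by
  have hmem (θ : ℝ) : circleMap 0 1 θ ∈ sphere (0 : ℂ) 1 := circleMap_mem_sphere 0 zero_le_one θ
  let e : ℝ → sphere (0 : ℂ) 1 := fun θ ↦ ⟨circleMap 0 1 θ, hmem θ⟩
  have he : Continuous e := (continuous_circleMap 0 1).subtype_mk _
  let d : ℝ → ℝ := fun θ ↦ (2 * π)⁻¹ * u (circleMap 0 1 θ)
  have hd : Continuous d :=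
    continuous_const.mul (hu.comp_continuous (continuous_circleMap 0 1) hmem)
  have hd0 (θ : ℝ) : 0 ≤ d θ := mul_nonneg (by positivity) (hu0 _ (hmem θ))
  let ρ : Measure ℝ := (volume.restrict (Ioc 0 (2 * π))).withDensity fun θ ↦ ENNReal.ofReal (d θ)
  have hρ : IsFiniteMeasure ρ :=
    isFiniteMeasure_withDensity_ofReal (hd.integrableOn_Ioc).2
  refine ⟨⟨ρ.map e, inferInstance⟩, fun g hg ↦ ?_⟩
  have hgm : Continuous fun ζ : sphere (0 : ℂ) 1 ↦ g ζ :=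
    hg.comp_continuous continuous_subtype_val fun ζ ↦ ζ.2
  rw [FiniteMeasure.toMeasure_mk, integral_map he.aemeasurable hgm.aestronglyMeasurable,
    integral_withDensity_eq_integral_toReal_smul (by fun_prop) (by simp),
    Real.circleAverage_def, intervalIntegral.integral_of_le (by positivity), ← integral_smul]
  congr with θ
  rw [ENNReal.toReal_ofReal (hd0 θ)]
  simp only [e, d, real_smul]
  push_cast
  ring

/-- **Herglotz representation** on the unit disk. -/
theorem exists_finiteMeasure_eq_integral_herglotzRieszKernel {F : ℂ → ℂ}
    (hF : DifferentiableOn ℂ F (ball 0 1)) (hpos : ∀ w ∈ ball (0 : ℂ) 1, 0 ≤ (F w).re) :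
    ∃ ν : FiniteMeasure (sphere (0 : ℂ) 1), ∀ w ∈ ball (0 : ℂ) 1,
      F w = I * (F 0).im
        + ∫ ζ, herglotzRieszKernel 0 w ζ ∂(ν : Measure (sphere (0 : ℂ) 1)) := by
  let r : ℕ → ℝ := fun n ↦ 1 - 1 / ((n : ℝ) + 1)
  have hr0 (n : ℕ) : 0 ≤ r n := by
    have : 1 / ((n : ℝ) + 1) ≤ 1 := by
      rw [div_le_one (by positivity)]; simp
    simp only [r]; linarith
  have hr1 (n : ℕ) : r n < 1 := by
    have : 0 < 1 / ((n : ℝ) + 1) := by positivity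
    simp only [r]; linarith
  have hr : Tendsto r atTop (𝓝 1) := by
    simpa [r] using tendsto_const_nhds.sub (tendsto_one_div_add_atTop_nhds_zero_nat (𝕜 := ℝ))
  have hmaps (n : ℕ) {ζ : ℂ} (hζ : ζ ∈ closedBall (0 : ℂ) 1) : (r n : ℂ) * ζ ∈ ball (0 : ℂ) 1 := by
    have h1 : ‖ζ‖ ≤ 1 := by simpa using hζ
    simp only [mem_ball_zero_iff, norm_mul, Complex.norm_real, Real.norm_of_nonneg (hr0 n)]
    nlinarith [hr0 n, hr1 n, norm_nonneg ζ]
  have hFr (n : ℕ) : DiffContOnCl ℂ (fun ζ ↦ F (r n * ζ)) (ball 0 1) := by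
    apply DifferentiableOn.diffContOnCl
    rw [closure_ball 0 one_ne_zero]
    exact hF.comp (by fun_prop) fun ζ hζ ↦ hmaps n hζ
  have hex (n : ℕ) := exists_finiteMeasure_integral_eq_circleAverage
    (u := fun ζ ↦ (F (r n * ζ)).re)
    (Complex.continuous_re.comp_continuousOn
      ((hFr n).2.mono (sphere_subset_closedBall.trans_eq (closure_ball 0 one_ne_zero).symm)))
    (fun ζ hζ ↦ hpos _ (hmaps n (sphere_subset_closedBall hζ)))
  choose ν hν using hex
  have hker {w : ℂ} (hw : w ∈ ball (0 : ℂ) 1) :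
      ContinuousOn (herglotzRieszKernel 0 w) (sphere 0 1) := by
    simpa using continuousOn_herglotzRieszKernel_sphere hw
  have hrep (n : ℕ) {w : ℂ} (hw : w ∈ ball (0 : ℂ) 1) :
      ∫ ζ, herglotzRieszKernel 0 w ζ ∂(ν n : Measure (sphere (0 : ℂ) 1))
        = F (r n * w) - I * (F 0).im := by
    rw [hν n _ (hker hw)]
    simpa using (hFr n).circleAverage_herglotzRieszKernel_mul_re hw
  have hmass (n : ℕ) : ν n ∈ {μ : FiniteMeasure (sphere (0 : ℂ) 1) | μ.mass = (F 0).re.toNNReal} := by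
    have h := hrep n (w := 0) (by simp)
    have h1 : ∀ ζ : sphere (0 : ℂ) 1, herglotzRieszKernel 0 0 (ζ : ℂ) = 1 := by
      intro ζ
      have : (ζ : ℂ) ≠ 0 := by
        intro h0; have := ζ.2; rw [h0] at this; simp at this
      simp [herglotzRieszKernel_def, this]
    simp only [h1, mul_zero, integral_const] at h
    have h2 : ((ν n : Measure (sphere (0 : ℂ) 1)).real univ) = (F 0).re := by
      simpa using congrArg Complex.re h
    rw [Set.mem_ofPred_eq, ← h2]
    exact (Real.toNNReal_coe (r := (ν n).mass)).symm
  obtain ⟨ν', -, hν'⟩ := (isCompact_setOfPred_finiteMeasure_eq_of_compactSpace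
      (sphere (0 : ℂ) 1) (F 0).re.toNNReal).ultrafilter_le_nhds
    ((hyperfilter ℕ).map ν) (by
      rw [Filter.le_principal_iff, Ultrafilter.coe_map, Filter.mem_map]
      exact Filter.Eventually.of_forall hmass)
  have hlim : Tendsto ν (hyperfilter ℕ) (𝓝 ν') := hν'
  refine ⟨ν', fun w hw ↦ ?_⟩
  let K : BoundedContinuousFunction (sphere (0 : ℂ) 1) ℂ := BoundedContinuousFunction.mkOfCompact
    ⟨fun ζ ↦ herglotzRieszKernel 0 w ζ,
      (hker hw).comp_continuous continuous_subtype_val fun ζ ↦ ζ.2⟩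
  have h1 := (FiniteMeasure.tendsto_iff_forall_integral_rclike_tendsto ℂ).1 hlim K
  have h2 : Tendsto (fun n ↦ F (r n * w) - I * (F 0).im) (hyperfilter ℕ)
      (𝓝 (F w - I * (F 0).im)) := by
    refine Tendsto.mono_left ?_ (Nat.hyperfilter_le_atTop)
    refine Tendsto.sub_const ?_ _
    have hc : ContinuousAt F w := (hF.differentiableAt (isOpen_ball.mem_nhds hw)).continuousAt
    refine hc.tendsto.comp ?_
    have := (Complex.continuous_ofReal.tendsto 1).comp hr
    simpa using this.mul_const w
  have h3 : Tendsto (fun n ↦ F (r n * w) - I * (F 0).im) (hyperfilter ℕ)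
      (𝓝 (∫ ζ, herglotzRieszKernel 0 w ζ ∂(ν' : Measure (sphere (0 : ℂ) 1)))) := by
    refine h1.congr fun n ↦ ?_
    exact hrep n hw
  rw [← tendsto_nhds_unique h2 h3]
  ring

/-- Under the Cayley transform `ζ ↦ i (1 + ζ) / (1 - ζ)`, the Herglotz–Riesz kernel on the circle
becomes the regularized Cauchy kernel on the line, up to the density `t ^ 2 + 1`. -/
theorem herglotzRieszKernel_cayley {ζ z : ℂ} (hζ : ζ ∈ sphere (0 : ℂ) 1) (hζ1 : ζ ≠ 1)
    (hz : 0 < z.im) :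
    herglotzRieszKernel 0 ((z - I) / (z + I)) ζ =
      -I * (((I * (1 + ζ) / (1 - ζ)).re ^ 2 + 1 : ℝ) *
        ((((I * (1 + ζ) / (1 - ζ)).re : ℂ) - z)⁻¹ - ((I * (1 + ζ) / (1 - ζ)).re : ℂ) /
          (((I * (1 + ζ) / (1 - ζ)).re : ℂ) ^ 2 + 1))) := by
  have hz0 : ζ ≠ 0 := by rintro rfl; simp at hζ
  have hcz : conj ζ = ζ⁻¹ := by
    rw [Complex.inv_def, Complex.normSq_eq_norm_sq]
    simp [show ‖ζ‖ = 1 by simpa using hζ]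
  have h1 : 1 - ζ ≠ 0 := sub_ne_zero.2 hζ1.symm
  have hreal : ((I * (1 + ζ) / (1 - ζ)).re : ℂ) = I * (1 + ζ) / (1 - ζ) := by
    rw [← Complex.conj_eq_iff_re]
    simp only [map_div₀, map_mul, map_add, map_sub, map_one, conj_I, hcz]
    have : 1 - ζ⁻¹ ≠ 0 := by
      rw [show 1 - ζ⁻¹ = -((1 - ζ) * ζ⁻¹) by field_simp; ring]
      exact neg_ne_zero.2 (mul_ne_zero h1 (inv_ne_zero hz0))
    rw [div_eq_div_iff this h1]
    field_simp
    ring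
  set t : ℝ := (I * (1 + ζ) / (1 - ζ)).re with ht
  have htz : (t : ℂ) - z ≠ 0 := by
    intro h
    have := congrArg Complex.im h
    simp at this
    linarith
  have hzi : z + I ≠ 0 := by
    intro h
    have := congrArg Complex.im h
    simp at this
    linarith
  have hti : (t : ℂ) + I ≠ 0 := by
    intro h
    have := congrArg Complex.im h
    simp at this
  have ht2 : (t : ℂ) ^ 2 + 1 ≠ 0 := by
    norm_cast
    positivity
  have hζt : ζ = (t - I) / (t + I) := by
    rw [eq_div_iff hti, hreal]
    field_simp
    ring
  rw [herglotzRieszKernel_def, hζt, sub_zero, sub_zero,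
    show (t - I) / (t + I) + (z - I) / (z + I) = 2 * (1 + t * z) / ((t + I) * (z + I)) by
      field_simp; ring_nf; rw [I_sq]; ring,
    show (t - I) / (t + I) - (z - I) / (z + I) = 2 * I * (t - z) / ((t + I) * (z + I)) by
      field_simp; ring,
    div_div_div_cancel_right₀ (mul_ne_zero hti hzi)]
  push_cast
  field_simp
  ring_nf
  rw [I_sq]
  ring

/-- Herglotz representation theorem: every Carathéodory function (analytic with
positive real part on the open upper half-plane) admits the integral representation
`φ(z) = iA - iBz - i ∫ (1/(t-z) - t/(t²+1)) dμ(t)` with `A ∈ ℝ`, `B ≥ 0` and `μ`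
a positive Borel measure on `ℝ` with `∫ dμ(t)/(t²+1) < ∞`. -/
theorem herglotz_representation (φ : ℂ → ℂ)
    (hφ : DifferentiableOn ℂ φ {z : ℂ | 0 < z.im})
    (hpos : ∀ z : ℂ, 0 < z.im → 0 < (φ z).re) :
    ∃ (A B : ℝ) (μ : Measure ℝ),
      0 ≤ B ∧
      Integrable (fun t : ℝ => (t ^ 2 + 1)⁻¹) μ ∧
      ∀ z : ℂ, 0 < z.im →
        φ z = Complex.I * (A : ℂ) - Complex.I * (B : ℂ) * z
          - Complex.I *
            ∫ t : ℝ, (((t : ℂ) - z)⁻¹ - (t : ℂ) / ((t : ℂ) ^ 2 + 1)) ∂μ := by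
  have hC {w : ℂ} (hw : w ∈ ball (0 : ℂ) 1) : 1 - w ≠ 0 := by
    intro h
    rw [← sub_eq_zero.1 h] at hw
    simp at hw
  have hCim {w : ℂ} (hw : w ∈ ball (0 : ℂ) 1) : 0 < (I * (1 + w) / (1 - w)).im := by
    have h1 : w.re ^ 2 + w.im ^ 2 < 1 := by
      have h2 : ‖w‖ < 1 := by simpa using hw
      have h3 := Complex.sq_norm w
      rw [Complex.normSq_apply] at h3
      nlinarith [norm_nonneg w]
    have h2 := Complex.normSq_pos.2 (hC hw)
    rw [Complex.div_im, ← sub_div]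
    apply div_pos _ h2
    simp
    nlinarith
  obtain ⟨ν, hν⟩ := exists_finiteMeasure_eq_integral_herglotzRieszKernel
    (F := fun w ↦ φ (I * (1 + w) / (1 - w)))
    (hφ.comp (by fun_prop (disch := exact fun _ ↦ hC)) fun w hw ↦ hCim hw)
    (fun w hw ↦ (hpos _ (hCim hw)).le)
  let p : sphere (0 : ℂ) 1 := ⟨1, by simp⟩
  let T : sphere (0 : ℂ) 1 → ℝ := fun ζ ↦ (I * (1 + (ζ : ℂ)) / (1 - ζ)).re
  have hT : Measurable T := by fun_prop
  let m : Measure (sphere (0 : ℂ) 1) := (ν : Measure (sphere (0 : ℂ) 1)).restrict {p}ᶜ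
  have hdens (t : ℝ) : (ENNReal.ofReal (t ^ 2 + 1)).toReal = t ^ 2 + 1 :=
    ENNReal.toReal_ofReal (by positivity)
  refine ⟨(φ I).im, (ν : Measure (sphere (0 : ℂ) 1)).real {p},
    (m.map T).withDensity fun t ↦ ENNReal.ofReal (t ^ 2 + 1), measureReal_nonneg, ?_, ?_⟩
  · rw [integrable_withDensity_iff_integrable_smul' (by fun_prop) (by simp)]
    refine (integrable_const (1 : ℝ)).congr (ae_of_all _ fun t ↦ ?_)
    simp only [hdens, smul_eq_mul]
    field_simp
  · intro z hz
    have hzi : z + I ≠ 0 := by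
      intro h
      have := congrArg Complex.im h
      simp at this
      linarith
    have hw : (z - I) / (z + I) ∈ ball (0 : ℂ) 1 := by
      rw [mem_ball_zero_iff, norm_div, div_lt_one (norm_pos_iff.2 hzi),
        ← sq_lt_sq₀ (norm_nonneg _) (norm_nonneg _), Complex.sq_norm, Complex.sq_norm,
        Complex.normSq_apply, Complex.normSq_apply]
      simp
      nlinarith
    have hinv : I * (1 + (z - I) / (z + I)) / (1 - (z - I) / (z + I)) = z := by
      rw [show 1 + (z - I) / (z + I) = 2 * z / (z + I) by field_simp; ring,
        show 1 - (z - I) / (z + I) = 2 * I / (z + I) by field_simp; ring]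
      field_simp
    have h := hν _ hw
    simp only [hinv] at h
    have hint : Integrable (fun ζ : sphere (0 : ℂ) 1 ↦
        herglotzRieszKernel 0 ((z - I) / (z + I)) ζ) (ν : Measure (sphere (0 : ℂ) 1)) := by
      have hc : Continuous fun ζ : sphere (0 : ℂ) 1 ↦
          herglotzRieszKernel 0 ((z - I) / (z + I)) ζ :=
        ContinuousOn.comp_continuous (by simpa using continuousOn_herglotzRieszKernel_sphere hw)
          continuous_subtype_val fun ζ ↦ ζ.2
      exact (BoundedContinuousFunction.mkOfCompact ⟨_, hc⟩).integrable _
    have hp : herglotzRieszKernel 0 ((z - I) / (z + I)) p = -I * z := by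
      rw [herglotzRieszKernel_def, sub_zero, sub_zero]
      conv_rhs => rw [← hinv, mul_div_assoc, ← mul_assoc, neg_mul, I_mul_I, neg_neg, one_mul]
    rw [h, ← integral_add_compl (measurableSet_singleton p) hint, integral_singleton, hp,
      integral_withDensity_eq_integral_toReal_smul (by fun_prop) (by simp),
      integral_map hT.aemeasurable (Measurable.aestronglyMeasurable (by fun_prop)),
      setIntegral_congr_fun (measurableSet_singleton p).compl fun ζ hζ ↦
        herglotzRieszKernel_cayley ζ.2 (fun h1 ↦ hζ (Subtype.ext h1)) hz, integral_const_mul]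
    simp only [hdens, real_smul, m, T, add_zero, sub_zero, div_one, mul_one]
    ring
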